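/- Let n ≥ 4 and let G be the path graph on n vertices v₁, …, v_n (with edges exactly {v_i, v_{i+1}} for 1 ≤ i ≤ n−1). Then G admits no admissible weight system. -/

import Mathlib

/-- A subset `S` of the vertices of a simple graph `G` is a *tube* if the
subgraph of `G` induced on `S` is (nonempty and) connected. -/
def IsTube {V : Type*} (G : SimpleGraph V) (S : Finset V) : Prop :=
  (G.induce (S : Set V)).Connected

/-- A subset `D` of the vertices of a simple graph `G` is a *non-tube* if `D`
is nonempty and the subgraph of `G` induced on `D` is not connected. -/
def IsNonTube {V : Type*} (G : SimpleGraph V) (D : Finset V) : Prop :=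
  D.Nonempty ∧ ¬ (G.induce (D : Set V)).Connected

/-- An *admissible weight system* for `G` is a pair `(c₀, c)` with values in
`(0,1]` such that (W1) for every nontrivial tube `T`, `c₀ + ∑_{v ∈ T} c v > 1`,
and (W2) for every non-tube `D`, `c₀ + ∑_{v ∈ D} c v ≤ 1`. -/
def IsAdmissible {V : Type*} (G : SimpleGraph V) (c₀ : ℝ) (c : V → ℝ) : Prop :=
  (0 < c₀ ∧ c₀ ≤ 1) ∧ (∀ v, 0 < c v ∧ c v ≤ 1) ∧
  (∀ T : Finset V, IsTube G T → 2 ≤ T.card → 1 < c₀ + ∑ v ∈ T, c v) ∧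
  (∀ D : Finset V, IsNonTube G D → c₀ + ∑ v ∈ D, c v ≤ 1)

theorem isTube_pair {V : Type*} [DecidableEq V] {G : SimpleGraph V} {a b : V} (h : G.Adj a b) :
    IsTube G {a, b} := by
  unfold IsTube
  rw [Finset.coe_pair]
  exact SimpleGraph.induce_pair_connected_of_adj h

theorem isNonTube_pair {V : Type*} [DecidableEq V] {G : SimpleGraph V} {a b : V}
    (hab : a ≠ b) (h : ¬ G.Adj a b) : IsNonTube G {a, b} := by
  refine ⟨by simp, fun hc => ?_⟩
  let x : (({a, b} : Finset V) : Set V) := ⟨a, by simp⟩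
  let y : (({a, b} : Finset V) : Set V) := ⟨b, by simp⟩
  have : Nontrivial (({a, b} : Finset V) : Set V) :=
    ⟨x, y, fun hxy => hab (congrArg Subtype.val hxy)⟩
  obtain ⟨⟨z, hz⟩, hadj⟩ := hc.preconnected.exists_adj_of_nontrivial x
  have hadj : G.Adj a z := hadj
  rcases (by simpa using hz : z = a ∨ z = b) with rfl | rfl
  · exact hadj.ne rfl
  · exact h hadj

/-- The path graph on `n ≥ 4` vertices admits no admissible weight system. -/
theorem path_not_admissible (n : ℕ) (hn : 4 ≤ n) (G : SimpleGraph (Fin n))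
    (hG : ∀ a b, G.Adj a b ↔ ((a : ℕ) + 1 = (b : ℕ) ∨ (b : ℕ) + 1 = (a : ℕ))) :
    ¬ ∃ (c₀ : ℝ) (c : Fin n → ℝ), IsAdmissible G c₀ c := by
  rintro ⟨c₀, c, -, -, hT, hD⟩
  have tube (a b : Fin n) (h : (a : ℕ) + 1 = b) : 1 < c₀ + (c a + c b) := by
    have hab : a ≠ b := by rintro rfl; omega
    have := hT {a, b} (isTube_pair ((hG a b).2 (Or.inl h))) (Finset.card_pair hab).ge
    rwa [Finset.sum_pair hab] at this
  have nontube (a b : Fin n) (h : (a : ℕ) + 2 = b) : c₀ + (c a + c b) ≤ 1 := by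
    have hab : a ≠ b := by rintro rfl; omega
    have := hD {a, b} (isNonTube_pair hab (by rw [hG]; omega))
    rwa [Finset.sum_pair hab] at this
  have h₁ := tube ⟨0, by omega⟩ ⟨1, by omega⟩ rfl
  have h₂ := tube ⟨2, by omega⟩ ⟨3, by omega⟩ rfl
  have h₃ := nontube ⟨0, by omega⟩ ⟨2, by omega⟩ rfl
  have h₄ := nontube ⟨1, by omega⟩ ⟨3, by omega⟩ rfl
  linarith
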